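/- arXiv:0909.5577 — 4 statements merged into one kernel-verified Lean document; each statement's English description precedes it below -/
import Mathlib

section
/- Let C, M_1, …, M_l be real symmetric positive semidefinite n×n matrices. The range (column space) of C is contained in the range of Σ_{i=1}^l M_i if and only if there exists a vector μ ∈ ℝ^l with μ_i ≥ 0 for all i such that Σ_{i=1}^l μ_i M_i − C is positive semidefinite (i.e., the Lagrangian dual (D) of the semidefinite packing problem is feasible). Moreover, in this case μ can be chosen of the form μ_i = λ for all i with a single scalar λ > 0. -/
open Matrix

lemma aux_factor {n : ℕ} (A B : Matrix (Fin n) (Fin n) ℝ)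
    (h : ∀ x, A *ᵥ x = 0 → B *ᵥ x = 0) : ∃ Z : Matrix (Fin n) (Fin n) ℝ, B = Z * A := by
  have hk : LinearMap.ker A.mulVecLin ≤ LinearMap.ker B.mulVecLin := fun x hx => by
    simpa using h x (by simpa using hx)
  obtain ⟨g, hg⟩ := LinearMap.exists_extend
    (((LinearMap.ker A.mulVecLin).liftQ B.mulVecLin hk).comp
      A.mulVecLin.quotKerEquivRange.symm.toLinearMap)
  refine ⟨LinearMap.toMatrix' g, ?_⟩
  apply Matrix.mulVec_injective
  funext x
  rw [← Matrix.mulVec_mulVec, LinearMap.toMatrix'_mulVec]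
  have := LinearMap.congr_fun hg (A.mulVecLin.rangeRestrict x)
  have e : A.mulVecLin.quotKerEquivRange.symm (A.mulVecLin.rangeRestrict x)
      = (LinearMap.ker A.mulVecLin).mkQ x := by
    rw [LinearEquiv.symm_apply_eq]; rfl
  simp only [LinearMap.comp_apply, LinearEquiv.coe_coe, e] at this
  simpa using this.symm

lemma aux_sqrt {n : ℕ} {A : Matrix (Fin n) (Fin n) ℝ} (hA : A.PosSemidef) :
    ∃ B : Matrix (Fin n) (Fin n) ℝ, A = Bᵀ * B := by
  open scoped MatrixOrder Matrix.Norms.L2Operator in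
  obtain ⟨B, hB⟩ := CStarAlgebra.nonneg_iff_eq_star_mul_self.mp hA.nonneg
  exact ⟨B, by simpa [star_eq_conjTranspose] using hB⟩

lemma aux_form {n : ℕ} (B : Matrix (Fin n) (Fin n) ℝ) (x : Fin n → ℝ) :
    x ⬝ᵥ ((Bᵀ * B) *ᵥ x) = ∑ i, (B *ᵥ x) i ^ 2 := by
  rw [← Matrix.mulVec_mulVec, Matrix.dotProduct_mulVec, Matrix.vecMul_transpose]
  simp [dotProduct, sq]

lemma aux_bound {n : ℕ} (Z : Matrix (Fin n) (Fin n) ℝ) (y : Fin n → ℝ) :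
    ∑ i, (Z *ᵥ y) i ^ 2 ≤ (∑ i, ∑ j, Z i j ^ 2) * ∑ j, y j ^ 2 := by
  rw [Finset.sum_mul]
  exact Finset.sum_le_sum fun i _ => Finset.sum_mul_sq_le_sq_mul_sq Finset.univ (Z i) y

lemma aux_dom {n : ℕ} {C S : Matrix (Fin n) (Fin n) ℝ} (hC : C.PosSemidef) (hS : S.PosSemidef)
    (h : LinearMap.range C.mulVecLin ≤ LinearMap.range S.mulVecLin) :
    ∃ lam : ℝ, 0 < lam ∧ (lam • S - C).PosSemidef := by
  have hCt : Cᵀ = C := by simpa using hC.isHermitian.eq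
  have hSt : Sᵀ = S := by simpa using hS.isHermitian.eq
  obtain ⟨A, hA⟩ := aux_sqrt hS
  obtain ⟨B, hB⟩ := aux_sqrt hC
  have hk : ∀ x, A *ᵥ x = 0 → B *ᵥ x = 0 := by
    intro x hx
    have hSx : S *ᵥ x = 0 := by rw [hA, ← Matrix.mulVec_mulVec, hx, Matrix.mulVec_zero]
    have h0 : x ⬝ᵥ (C *ᵥ x) = 0 := by
      obtain ⟨z, hz⟩ := h ⟨x, rfl⟩
      simp only [Matrix.mulVecLin_apply] at hz
      rw [← hz, Matrix.dotProduct_mulVec, ← Matrix.mulVec_transpose, hSt, hSx, zero_dotProduct]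
    rw [hB, aux_form, Finset.sum_eq_zero_iff_of_nonneg (fun _ _ => sq_nonneg _)] at h0
    funext i
    simpa using h0 i (Finset.mem_univ i)
  obtain ⟨Z, hZ⟩ := aux_factor A B hk
  have hnn : 0 ≤ ∑ i, ∑ j, Z i j ^ 2 :=
    Finset.sum_nonneg fun _ _ => Finset.sum_nonneg fun _ _ => sq_nonneg _
  refine ⟨(∑ i, ∑ j, Z i j ^ 2) + 1, by linarith, ?_⟩
  refine PosSemidef.of_dotProduct_mulVec_nonneg ?_ fun x => ?_
  · simp [Matrix.IsHermitian, hCt, hSt]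
  · have h1 := aux_bound Z (A *ᵥ x)
    rw [Matrix.mulVec_mulVec, ← hZ, ← aux_form, ← aux_form, ← hA, ← hB] at h1
    have h2 : 0 ≤ x ⬝ᵥ (S *ᵥ x) := by simpa using hS.dotProduct_mulVec_nonneg x
    simp only [star_trivial, Matrix.sub_mulVec, Matrix.smul_mulVec, dotProduct_sub,
      dotProduct_smul, smul_eq_mul]
    linarith

lemma aux_range {n : ℕ} {C S : Matrix (Fin n) (Fin n) ℝ} (hC : C.PosSemidef) (hS : S.PosSemidef)
    (h : ∀ x, S *ᵥ x = 0 → C *ᵥ x = 0) :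
    LinearMap.range C.mulVecLin ≤ LinearMap.range S.mulVecLin := by
  have hCt : Cᵀ = C := by simpa using hC.isHermitian.eq
  have hSt : Sᵀ = S := by simpa using hS.isHermitian.eq
  obtain ⟨Z, hZ⟩ := aux_factor S C h
  have h2 : C = S * Zᵀ := by rw [← hCt, hZ, Matrix.transpose_mul, hSt]
  rintro _ ⟨x, rfl⟩
  exact ⟨Zᵀ *ᵥ x, by simp [Matrix.mulVec_mulVec, ← h2]⟩

/-- The range of `C` is contained in the range of `∑ i, M i` iff the Lagrangian dual (D)
of the semidefinite packing problem is feasible, i.e. there is `μ ≥ 0` with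
`∑ i, μ i • M i ⪰ C`.  Moreover, in that case `μ` can be chosen with all entries equal to
a single positive scalar `λ`. -/
theorem stmt_2 (n l : ℕ) (C : Matrix (Fin n) (Fin n) ℝ)
    (M : Fin l → Matrix (Fin n) (Fin n) ℝ)
    (hC : C.PosSemidef) (hM : ∀ i, (M i).PosSemidef) :
    (LinearMap.range C.mulVecLin ≤ LinearMap.range (∑ i, M i).mulVecLin ↔
      ∃ μ : Fin l → ℝ, (∀ i, 0 ≤ μ i) ∧ ((∑ i, μ i • M i) - C).PosSemidef) ∧
    (LinearMap.range C.mulVecLin ≤ LinearMap.range (∑ i, M i).mulVecLin →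
      ∃ lam : ℝ, 0 < lam ∧ ((∑ i, lam • M i) - C).PosSemidef) := by
  have hS : (∑ i, M i).PosSemidef := posSemidef_sum _ fun i _ => hM i
  have key : LinearMap.range C.mulVecLin ≤ LinearMap.range (∑ i, M i).mulVecLin →
      ∃ lam : ℝ, 0 < lam ∧ ((∑ i, lam • M i) - C).PosSemidef := by
    intro h
    obtain ⟨lam, h0, h1⟩ := aux_dom hC hS h
    exact ⟨lam, h0, by rwa [Finset.smul_sum] at h1⟩
  refine ⟨⟨fun h => ?_, ?_⟩, key⟩
  · obtain ⟨lam, h0, h1⟩ := key h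
    exact ⟨fun _ => lam, fun _ => h0.le, h1⟩
  · rintro ⟨μ, hμ, hp⟩
    refine aux_range hC hS fun x hx => ?_
    have hn : ∀ i, 0 ≤ x ⬝ᵥ (M i *ᵥ x) := fun i => by
      simpa using (hM i).dotProduct_mulVec_nonneg x
    have hs : ∑ i, x ⬝ᵥ (M i *ᵥ x) = 0 := by
      rw [← dotProduct_sum, ← Matrix.sum_mulVec, hx, dotProduct_zero]
    rw [Finset.sum_eq_zero_iff_of_nonneg (fun i _ => hn i)] at hs
    have h1 := hp.dotProduct_mulVec_nonneg x
    have h2 : x ⬝ᵥ ((∑ i, μ i • M i) *ᵥ x) = 0 := by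
      rw [Matrix.sum_mulVec, dotProduct_sum]
      refine Finset.sum_eq_zero fun i hi => ?_
      rw [Matrix.smul_mulVec, dotProduct_smul, hs i hi, smul_zero]
    rw [star_trivial, Matrix.sub_mulVec, dotProduct_sub, h2] at h1
    have h3 : 0 ≤ x ⬝ᵥ (C *ᵥ x) := by simpa using hC.dotProduct_mulVec_nonneg x
    refine (hC.dotProduct_mulVec_zero_iff x).mp ?_
    rw [star_trivial]
    linarith
end

section
/- Assume b_i ≥ 0 for every i ∈ {1,…,l}, C = c cᵀ for a vector c ∈ ℝ^n, each M_i = A_iᵀA_i for a matrix A_i, and the range of C is contained in the range of Σ_{i=1}^l M_i. Then the optimal value of the semidefinite packing problem (P) equals the square of the optimal value of the second-order cone program (SOCP): maximize cᵀx over x ∈ ℝ^n subject to ‖A_i x‖₂² ≤ b_i for all i ∈ {1,…,l}. Moreover, if x is any optimal solution of this SOCP, then X = x xᵀ is an optimal solution of (P), and the optimal value of (P) is (cᵀx)². -/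
open Matrix

lemma aux_cs {k n : ℕ} (A : Matrix (Fin k) (Fin n) ℝ) (v : Fin n → ℝ) :
    A.mulVec v ⬝ᵥ A.mulVec v ≤ (Aᵀ * A).trace * (v ⬝ᵥ v) := by
  have h1 : (Aᵀ * A).trace = ∑ j, ∑ i, A j i ^ 2 := by
    rw [Matrix.trace_mul_comm]
    simp [Matrix.trace, Matrix.mul_apply, sq]
  rw [h1, Finset.sum_mul]
  simp only [dotProduct, mulVec]
  apply Finset.sum_le_sum
  intro j _
  have := Finset.sum_mul_sq_le_sq_mul_sq Finset.univ (fun i => A j i) v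
  simpa [sq] using this

lemma aux_tr {n : ℕ} (c : Fin n → ℝ) (X : Matrix (Fin n) (Fin n) ℝ) :
    (vecMulVec c c * X).trace = c ⬝ᵥ X.mulVec c := by
  rw [Matrix.trace_mul_comm, Matrix.mul_vecMulVec, Matrix.trace_vecMulVec, dotProduct_comm]

open scoped MatrixOrder Matrix.Norms.L2Operator in
lemma aux_key {n : ℕ} (c : Fin n → ℝ) (X : Matrix (Fin n) (Fin n) ℝ) (hX : X.PosSemidef) :
    ∃ y : Fin n → ℝ, 0 ≤ c ⬝ᵥ y ∧ (vecMulVec c c * X).trace = (c ⬝ᵥ y) ^ 2 ∧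
      ∀ (k : ℕ) (A : Matrix (Fin k) (Fin n) ℝ),
        A.mulVec y ⬝ᵥ A.mulVec y ≤ (Aᵀ * A * X).trace := by
  obtain ⟨Y, hY⟩ := CStarAlgebra.nonneg_iff_eq_star_mul_self.mp hX.nonneg
  rw [star_eq_conjTranspose, Matrix.conjTranspose_eq_transpose_of_trivial] at hY
  have hq : c ⬝ᵥ X.mulVec c = Y.mulVec c ⬝ᵥ Y.mulVec c := by
    rw [hY, ← Matrix.mulVec_mulVec, Matrix.dotProduct_mulVec, Matrix.vecMul_transpose]
  have hq0 : 0 ≤ c ⬝ᵥ X.mulVec c := by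
    rw [hq]; exact Finset.sum_nonneg fun i _ => mul_self_nonneg _
  have hA : ∀ (k : ℕ) (A : Matrix (Fin k) (Fin n) ℝ),
      (Aᵀ * A * X).trace = ((A * Yᵀ)ᵀ * (A * Yᵀ)).trace := by
    intro k A
    rw [hY, Matrix.transpose_mul, Matrix.transpose_transpose, ← Matrix.mul_assoc,
      Matrix.trace_mul_comm]
    simp only [Matrix.mul_assoc]
  have hA0 : ∀ (k : ℕ) (A : Matrix (Fin k) (Fin n) ℝ), 0 ≤ (Aᵀ * A * X).trace := by
    intro k A
    rw [hA, Matrix.trace_mul_comm]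
    simp only [Matrix.trace, Matrix.diag_apply, Matrix.mul_apply (M := A * Yᵀ), Matrix.transpose_apply (A * Yᵀ)]
    exact Finset.sum_nonneg fun i _ => Finset.sum_nonneg fun j _ => mul_self_nonneg _
  set q := c ⬝ᵥ X.mulVec c with hqdef
  rcases hq0.eq_or_lt with h0 | hpos
  · refine ⟨0, by simp, by rw [aux_tr]; simp [← hqdef, ← h0], fun k A => ?_⟩
    simpa using hA0 k A
  · have hs : 0 < √q := Real.sqrt_pos.2 hpos
    have hss : √q * √q = q := Real.mul_self_sqrt hq0
    have hcy : c ⬝ᵥ ((√q)⁻¹ • X.mulVec c) = √q := by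
      rw [dotProduct_smul, ← hqdef, smul_eq_mul]
      field_simp
      nlinarith
    refine ⟨(√q)⁻¹ • X.mulVec c, ?_, ?_, ?_⟩
    · rw [hcy]; exact hs.le
    · rw [hcy, aux_tr, sq, hss]
    · intro k A
      have h := aux_cs (A * Yᵀ) (Y.mulVec c)
      rw [← hA, ← hq, Matrix.mulVec_mulVec, Matrix.mul_assoc, ← hY, ← Matrix.mulVec_mulVec] at h
      rw [Matrix.mulVec_smul, smul_dotProduct, dotProduct_smul, smul_eq_mul, smul_eq_mul,
        ← mul_assoc, ← mul_inv, hss, inv_mul_le_iff₀ hpos, mul_comm q]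
      exact h

lemma aux_rank1 {n k : ℕ} (x : Fin n → ℝ) (A : Matrix (Fin k) (Fin n) ℝ) :
    (Aᵀ * A * vecMulVec x x).trace = A.mulVec x ⬝ᵥ A.mulVec x := by
  rw [Matrix.mul_vecMulVec, Matrix.trace_vecMulVec, ← Matrix.mulVec_mulVec, dotProduct_comm,
    Matrix.dotProduct_mulVec, Matrix.vecMul_transpose]

lemma aux_val {n : ℕ} (c x : Fin n → ℝ) :
    (vecMulVec c c * vecMulVec x x).trace = (c ⬝ᵥ x) ^ 2 := by
  rw [aux_tr, Matrix.vecMulVec_mulVec]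
  simp [dotProduct_comm x c, sq]

lemma aux_psd {n : ℕ} (x : Fin n → ℝ) : (vecMulVec x x).PosSemidef := by
  simpa using Matrix.posSemidef_vecMulVec_self_star x

/-- If `C = c cᵀ` has rank one and `M i = A iᵀ * A i`, then the semidefinite packing
problem (P) reduces to an SOCP: its optimal value is the square of the optimal value of
`max cᵀx s.t. ‖A i x‖² ≤ b i`, and any optimal `x` of the SOCP yields the optimal
solution `X = x xᵀ` of (P), with optimal value `(cᵀx)²`. -/
theorem stmt_4 (n l : ℕ) (m : Fin l → ℕ) (c : Fin n → ℝ)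
    (A : ∀ i, Matrix (Fin (m i)) (Fin n) ℝ) (b : Fin l → ℝ) (hb : ∀ i, 0 ≤ b i)
    (hrange : LinearMap.range (vecMulVec c c).mulVecLin ≤
      LinearMap.range (∑ i, (A i)ᵀ * A i).mulVecLin) :
    sSup {t : ℝ | ∃ X : Matrix (Fin n) (Fin n) ℝ,
        (X.PosSemidef ∧ ∀ i, ((A i)ᵀ * A i * X).trace ≤ b i) ∧
        t = (vecMulVec c c * X).trace} =
      (sSup {t : ℝ | ∃ x : Fin n → ℝ,
        (∀ i, (A i).mulVec x ⬝ᵥ (A i).mulVec x ≤ b i) ∧ t = c ⬝ᵥ x}) ^ 2 ∧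
    ∀ x : Fin n → ℝ, (∀ i, (A i).mulVec x ⬝ᵥ (A i).mulVec x ≤ b i) →
      (∀ y : Fin n → ℝ, (∀ i, (A i).mulVec y ⬝ᵥ (A i).mulVec y ≤ b i) → c ⬝ᵥ y ≤ c ⬝ᵥ x) →
      ((vecMulVec x x).PosSemidef ∧
        (∀ i, ((A i)ᵀ * A i * vecMulVec x x).trace ≤ b i)) ∧
      (∀ X : Matrix (Fin n) (Fin n) ℝ, X.PosSemidef →
        (∀ i, ((A i)ᵀ * A i * X).trace ≤ b i) →
        (vecMulVec c c * X).trace ≤ (vecMulVec c c * vecMulVec x x).trace) ∧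
      (vecMulVec c c * vecMulVec x x).trace = (c ⬝ᵥ x) ^ 2 := by
  have hbdd : BddAbove {t : ℝ | ∃ x : Fin n → ℝ,
        (∀ i, (A i).mulVec x ⬝ᵥ (A i).mulVec x ≤ b i) ∧ t = c ⬝ᵥ x} := by
    have hc : ∃ u, (∑ i, (A i)ᵀ * A i).mulVec u = c := by
      by_cases h0 : c = 0
      · exact ⟨0, by simp [h0]⟩
      · have hcc : c ⬝ᵥ c ≠ 0 := by simpa using h0
        obtain ⟨u, hu⟩ := hrange ⟨(c ⬝ᵥ c)⁻¹ • c, rfl⟩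
        refine ⟨u, ?_⟩
        simp only [Matrix.mulVecLin_apply] at hu
        rw [hu, Matrix.mulVec_smul, Matrix.vecMulVec_mulVec]
        ext j
        simp
        field_simp
    obtain ⟨u, hu⟩ := hc
    refine ⟨∑ i, ((A i).mulVec u ⬝ᵥ (A i).mulVec u + b i), ?_⟩
    rintro t ⟨x, hx, rfl⟩
    rw [← hu, Matrix.sum_mulVec, sum_dotProduct]
    apply Finset.sum_le_sum
    intro i _
    rw [← Matrix.mulVec_mulVec, dotProduct_comm, Matrix.dotProduct_mulVec, Matrix.vecMul_transpose]
    refine le_trans ?_ (add_le_add_right (hx i) _)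
    simp only [dotProduct]
    rw [← Finset.sum_add_distrib]
    apply Finset.sum_le_sum
    intro j _
    nlinarith [sq_nonneg ((A i).mulVec x j - (A i).mulVec u j),
      sq_nonneg ((A i).mulVec x j + (A i).mulVec u j)]
  have h0f : ∀ i, (A i).mulVec (0 : Fin n → ℝ) ⬝ᵥ (A i).mulVec 0 ≤ b i := by
    intro i; simpa using hb i
  constructor
  · set S := {t : ℝ | ∃ x : Fin n → ℝ,
        (∀ i, (A i).mulVec x ⬝ᵥ (A i).mulVec x ≤ b i) ∧ t = c ⬝ᵥ x} with hS
    have hub : ∀ t ∈ {t : ℝ | ∃ X : Matrix (Fin n) (Fin n) ℝ,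
        (X.PosSemidef ∧ ∀ i, ((A i)ᵀ * A i * X).trace ≤ b i) ∧
        t = (vecMulVec c c * X).trace}, t ≤ (sSup S) ^ 2 := by
      rintro t ⟨X, ⟨hX, hf⟩, rfl⟩
      obtain ⟨y, hy0, hy, hyA⟩ := aux_key c X hX
      rw [hy]
      have : c ⬝ᵥ y ≤ sSup S := le_csSup hbdd ⟨y, fun i => (hyA _ _).trans (hf i), rfl⟩
      gcongr
    apply le_antisymm
    · exact csSup_le ⟨_, 0, ⟨Matrix.PosSemidef.zero, fun i => by simpa using hb i⟩, rfl⟩ hub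
    · have hS0 : 0 ≤ sSup S := le_csSup hbdd ⟨0, h0f, by simp⟩
      refine (Real.le_sqrt hS0 ?_).1 ?_
      · exact le_csSup ⟨_, hub⟩ ⟨0, ⟨Matrix.PosSemidef.zero, fun i => by simpa using hb i⟩, by simp⟩
      · refine csSup_le (s := S) ⟨_, 0, h0f, rfl⟩ ?_
        rintro s ⟨x, hx, rfl⟩
        apply Real.le_sqrt_of_sq_le
        exact le_csSup ⟨_, hub⟩
          ⟨vecMulVec x x, ⟨aux_psd x, fun i => by rw [aux_rank1]; exact hx i⟩, (aux_val c x).symm⟩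
  · intro x hx hopt
    refine ⟨⟨aux_psd x, fun i => by rw [aux_rank1]; exact hx i⟩, ?_, aux_val c x⟩
    intro X hX hf
    obtain ⟨y, hy0, hy, hyA⟩ := aux_key c X hX
    rw [hy, aux_val]
    have := hopt y fun i => (hyA _ _).trans (hf i)
    gcongr
end

section
/- Assume the combined semidefinite packing problem (P_CMB) has a feasible triple, and that the refined Slater condition holds for its dual: there exists μ̄ ∈ ℝ^l with μ̄ ≥ 0 such that Σ_i μ̄_i M_i − C is positive definite, R_0 + Σ_i μ̄_i R_i is negative definite, and h_0 + Hμ̄ = 0. If rank C = r, then (P_CMB) attains its supremum at some feasible triple (X, Y, λ) with rank X ≤ r. -/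
open Matrix

theorem aux_trace_mul {n : ℕ} {A B : Matrix (Fin n) (Fin n) ℝ} (hA : A.PosSemidef)
    (hB : B.PosSemidef) : 0 ≤ (A * B).trace := by
  obtain ⟨D, rfl⟩ : ∃ D : Matrix (Fin n) (Fin n) ℝ, B = Dᴴ * D := by
    open scoped MatrixOrder in
    obtain ⟨D, hD⟩ := CStarAlgebra.nonneg_iff_eq_star_mul_self.mp (nonneg_iff_posSemidef.mpr hB)
    exact ⟨D, hD⟩
  rw [← Matrix.mul_assoc, Matrix.trace_mul_comm, ← Matrix.mul_assoc]
  exact (hA.mul_mul_conjTranspose_same D).trace_nonneg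

theorem aux_eps {n : ℕ} {S : Matrix (Fin n) (Fin n) ℝ} (hS : S.PosDef) :
    ∃ ε : ℝ, 0 < ε ∧ (S - ε • (1 : Matrix (Fin n) (Fin n) ℝ)).PosSemidef := by
  rcases Nat.eq_zero_or_pos n with rfl | hn
  · refine ⟨1, one_pos, ?_⟩
    rw [Subsingleton.elim (S - (1:ℝ) • (1 : Matrix (Fin 0) (Fin 0) ℝ)) 0]
    exact PosSemidef.zero
  · have : Nonempty (Fin n) := ⟨⟨0, hn⟩⟩
    obtain ⟨i, -, hi⟩ := Finset.exists_min_image Finset.univ hS.isHermitian.eigenvalues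
      Finset.univ_nonempty
    refine ⟨hS.isHermitian.eigenvalues i, hS.eigenvalues_pos i, ?_⟩
    have h1 := hS.isHermitian.spectral_theorem
    rw [Unitary.conjStarAlgAut_apply] at h1
    set U := hS.isHermitian.eigenvectorUnitary
    have h2 : S - hS.isHermitian.eigenvalues i • (1 : Matrix (Fin n) (Fin n) ℝ) =
      (U : Matrix (Fin n) (Fin n) ℝ) * diagonal (fun j => hS.isHermitian.eigenvalues j - hS.isHermitian.eigenvalues i) * (U : Matrix (Fin n) (Fin n) ℝ)ᴴ := by
      have : diagonal (fun j => hS.isHermitian.eigenvalues j - hS.isHermitian.eigenvalues i) =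
        diagonal (RCLike.ofReal ∘ hS.isHermitian.eigenvalues) - hS.isHermitian.eigenvalues i • (1 : Matrix (Fin n) (Fin n) ℝ) := by
        ext a b
        by_cases hab : a = b
        · subst hab; simp
        · simp [hab]
      rw [this, Matrix.mul_sub, Matrix.sub_mul]
      have hu : (U : Matrix (Fin n) (Fin n) ℝ) * (U : Matrix (Fin n) (Fin n) ℝ)ᴴ = 1 :=
        Unitary.coe_mul_star_self U
      rw [Matrix.mul_smul, Matrix.smul_mul, Matrix.mul_one, hu]
      congr 1
    rw [h2]
    refine PosSemidef.mul_mul_conjTranspose_same (PosSemidef.diagonal ?_) _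
    intro j
    simpa using hi j (Finset.mem_univ _)

theorem aux_proj {n : ℕ} {A : Matrix (Fin n) (Fin n) ℝ} (hA : A.IsHermitian) :
    ∃ P : Matrix (Fin n) (Fin n) ℝ, P.PosSemidef ∧ (1 - P).PosSemidef ∧ A * P = A ∧
      P.rank ≤ A.rank := by
  have h1 := hA.spectral_theorem
  rw [Unitary.conjStarAlgAut_apply] at h1
  have hr := hA.rank_eq_card_non_zero_eigs
  set U := hA.eigenvectorUnitary
  set ev := hA.eigenvalues
  have hu : (U : Matrix (Fin n) (Fin n) ℝ) * (U : Matrix (Fin n) (Fin n) ℝ)ᴴ = 1 :=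
        Unitary.coe_mul_star_self U
  have hu' : (U : Matrix (Fin n) (Fin n) ℝ)ᴴ * (U : Matrix (Fin n) (Fin n) ℝ) = 1 :=
        Unitary.coe_star_mul_self U
  change A = (U : Matrix (Fin n) (Fin n) ℝ) * diagonal ev * (U : Matrix (Fin n) (Fin n) ℝ)ᴴ at h1
  generalize (U : Matrix (Fin n) (Fin n) ℝ) = V at *
  let d : Fin n → ℝ := fun j => if ev j = 0 then 0 else 1
  refine ⟨V * diagonal d * Vᴴ, ?_, ?_, ?_, ?_⟩
  · refine PosSemidef.mul_mul_conjTranspose_same (PosSemidef.diagonal ?_) _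
    intro j; simp only [d]; split_ifs <;> simp
  · have : 1 - V * diagonal d * Vᴴ = V * diagonal (fun j => 1 - d j) * Vᴴ := by
      have e : diagonal (fun j => 1 - d j) = 1 - diagonal d := by
        rw [← diagonal_one, diagonal_sub]
      rw [e, Matrix.mul_sub, Matrix.sub_mul, Matrix.mul_one, hu]
    rw [this]
    refine PosSemidef.mul_mul_conjTranspose_same (PosSemidef.diagonal ?_) _
    intro j; simp only [d]; split_ifs <;> simp
  · have : diagonal ev * diagonal d = diagonal ev := by
      rw [diagonal_mul_diagonal]; congr 1; ext j; simp only [d]; split_ifs with h <;> simp [h]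
    calc A * (V * diagonal d * Vᴴ) = V * diagonal ev * (Vᴴ * V) * diagonal d * Vᴴ := by
          rw [h1]; simp only [Matrix.mul_assoc]
      _ = V * (diagonal ev * diagonal d) * Vᴴ := by rw [hu']; simp only [Matrix.mul_assoc, Matrix.one_mul]
      _ = A := by rw [this, ← h1]
  · rw [hr]
    refine (rank_mul_le_left _ _).trans ((rank_mul_le_right _ _).trans ?_)
    rw [rank_diagonal]
    refine le_of_eq (Fintype.card_congr (Equiv.subtypeEquivRight fun j => ?_))
    simp [d]

theorem aux_rank {n : ℕ} {C X : Matrix (Fin n) (Fin n) ℝ} (hC : C.PosSemidef)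
    (hX : X.PosSemidef) : ∃ X' : Matrix (Fin n) (Fin n) ℝ, X'.PosSemidef ∧ (X - X').PosSemidef ∧
      X'.rank ≤ C.rank ∧ (C * X').trace = (C * X).trace := by
  obtain ⟨D, rfl⟩ : ∃ D : Matrix (Fin n) (Fin n) ℝ, X = Dᴴ * D := by
    open scoped MatrixOrder in
    obtain ⟨D, hD⟩ := CStarAlgebra.nonneg_iff_eq_star_mul_self.mp (nonneg_iff_posSemidef.mpr hX)
    exact ⟨D, hD⟩
  obtain ⟨P, hP, hP1, hAP, hr⟩ := aux_proj (hC.mul_mul_conjTranspose_same D).isHermitian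
  refine ⟨Dᴴ * P * D, hP.conjTranspose_mul_mul_same D, ?_, ?_, ?_⟩
  · have := hP1.conjTranspose_mul_mul_same D
    rwa [Matrix.mul_sub, Matrix.sub_mul, Matrix.mul_one] at this
  · exact (rank_mul_le_left _ _).trans ((rank_mul_le_right _ _).trans (hr.trans
      ((rank_mul_le_left _ _).trans (rank_mul_le_right _ _))))
  · calc (C * (Dᴴ * P * D)).trace = (D * C * Dᴴ * P).trace := by
          rw [← Matrix.mul_assoc, Matrix.trace_mul_comm]; simp only [Matrix.mul_assoc]
      _ = (D * (C * Dᴴ)).trace := by rw [hAP, Matrix.mul_assoc]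
      _ = _ := by rw [Matrix.trace_mul_comm, Matrix.mul_assoc]

theorem aux_entry {n : ℕ} {X : Matrix (Fin n) (Fin n) ℝ} (hX : X.PosSemidef) (i j : Fin n) :
    |X i j| ≤ X.trace := by
  have hd : ∀ k, X k k ≤ X.trace := fun k =>
    Finset.single_le_sum (f := fun k => X k k) (fun k _ => hX.diag_nonneg) (Finset.mem_univ k)
  have hs : X j i = X i j := by simpa using hX.isHermitian.apply i j
  have h1 := hX.dotProduct_mulVec_nonneg (Pi.single i 1 + Pi.single j 1)
  have h2 := hX.dotProduct_mulVec_nonneg (Pi.single i 1 - Pi.single j 1)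
  simp [mulVec_add, mulVec_sub] at h1 h2
  rw [abs_le]
  constructor <;> linarith [hd i, hd j]

theorem aux_closed_psd (n : ℕ) : IsClosed {X : Matrix (Fin n) (Fin n) ℝ | X.PosSemidef} := by
  have : {X : Matrix (Fin n) (Fin n) ℝ | X.PosSemidef} =
    {X | Xᴴ = X} ∩ ⋂ v : Fin n → ℝ, {X | 0 ≤ star v ⬝ᵥ (X *ᵥ v)} := by
    ext X
    simp [posSemidef_iff_dotProduct_mulVec, IsHermitian]
  rw [this]
  refine IsClosed.inter (isClosed_eq (by fun_prop) (by fun_prop)) (isClosed_iInter fun v => ?_)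
  exact isClosed_le (by fun_prop) (by fun_prop)

theorem aux_between {α β : Type} [Fintype α] [Fintype β] (f : α → ℝ) (g : β → ℝ)
    (h : ∀ a b, f a ≤ g b) : ∃ t, (∀ a, f a ≤ t) ∧ ∀ b, t ≤ g b := by
  rcases isEmpty_or_nonempty α with hα | hα
  · obtain ⟨t, ht⟩ := (Set.finite_range g).bddBelow
    exact ⟨t, fun a => hα.elim a, fun b => ht ⟨b, rfl⟩⟩
  · obtain ⟨a, -, ha⟩ := Finset.exists_max_image Finset.univ f Finset.univ_nonempty
    exact ⟨f a, fun x => ha x (Finset.mem_univ _), fun b => h a b⟩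

theorem aux_poly (q : ℕ) : ∀ (ι : Type) [Fintype ι] (a : ι → Fin q → ℝ),
    IsClosed {d : ι → ℝ | ∃ v : Fin q → ℝ, ∀ i, d i ≤ a i ⬝ᵥ v} := by
  induction q with
  | zero =>
    intro ι _ a
    have : {d : ι → ℝ | ∃ v : Fin 0 → ℝ, ∀ i, d i ≤ a i ⬝ᵥ v} = ⋂ i, {d | d i ≤ 0} := by
      ext d; simp
    rw [this]
    exact isClosed_iInter fun i => isClosed_le (by fun_prop) (by fun_prop)
  | succ q ih =>
    intro ι _ a
    classical
    let α : ι → ℝ := fun i => a i 0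
    let a' : ι → Fin q → ℝ := fun i => vecTail (a i)
    let κ := {i // α i = 0} ⊕ ({i // 0 < α i} × {i // α i < 0})
    let B : κ → Fin q → ℝ := Sum.elim (fun i => a' i)
      (fun p => (α p.1)⁻¹ • a' p.1 - (α p.2)⁻¹ • a' p.2)
    let D : (ι → ℝ) → κ → ℝ := fun d => Sum.elim (fun i => d i)
      (fun p => (α p.1)⁻¹ * d p.1 - (α p.2)⁻¹ * d p.2)
    have hD : Continuous D := by
      refine continuous_pi fun k => ?_
      rcases k with k | k
      · simp only [D, Sum.elim_inl]; fun_prop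
      · simp only [D, Sum.elim_inr]; fun_prop
    convert (ih κ B).preimage hD using 1
    ext d
    simp only [Set.mem_ofPred_eq, Set.mem_preimage]
    have key : ∀ i (v : Fin (q+1) → ℝ), a i ⬝ᵥ v = α i * v 0 + a' i ⬝ᵥ vecTail v := by
      intro i v
      simp [dotProduct, Fin.sum_univ_succ, α, a', vecTail]
    constructor
    · rintro ⟨v, hv⟩
      refine ⟨vecTail v, ?_⟩
      rintro (i | ⟨i, j⟩)
      · have := hv i
        rw [key, i.2] at this
        simpa [D, B] using this
      · have h1 := mul_le_mul_of_nonneg_left (hv i) (inv_pos.2 i.2).le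
        have h2 := mul_le_mul_of_nonpos_left (hv j) (inv_lt_zero.2 j.2).le
        rw [key, mul_add, inv_mul_cancel_left₀ i.2.ne'] at h1
        rw [key, mul_add, inv_mul_cancel_left₀ j.2.ne] at h2
        simp only [D, B, Sum.elim_inr, sub_dotProduct, smul_dotProduct, smul_eq_mul]
        linarith
    · rintro ⟨w, hw⟩
      obtain ⟨t, ht1, ht2⟩ := aux_between
        (fun i : {i // 0 < α i} => (α i)⁻¹ * (d i - a' i ⬝ᵥ w))
        (fun i : {i // α i < 0} => (α i)⁻¹ * (d i - a' i ⬝ᵥ w)) (by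
          intro i j
          have := hw (Sum.inr (i, j))
          simp only [D, B, Sum.elim_inr, sub_dotProduct, smul_dotProduct, smul_eq_mul] at this
          linarith)
      refine ⟨vecCons t w, fun i => ?_⟩
      rw [key]
      simp only [cons_val_zero, tail_cons]
      rcases lt_trichotomy (α i) 0 with hi | hi | hi
      · have h := mul_le_mul_of_nonpos_left (ht2 ⟨i, hi⟩) hi.le
        simp only [mul_inv_cancel_left₀ hi.ne] at h
        linarith
      · have := hw (Sum.inl ⟨i, hi⟩)
        simp only [D, B, Sum.elim_inl] at this
        rw [hi]; linarith
      · have h := mul_le_mul_of_nonneg_left (ht1 ⟨i, hi⟩) hi.le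
        simp only [mul_inv_cancel_left₀ hi.ne'] at h
        linarith

/-- If the combined problem (P_CMB) is feasible and the refined Slater condition holds
for its dual, and `rank C = r`, then (P_CMB) attains its supremum at a feasible triple
`(X, Y, λ)` with `rank X ≤ r`. -/
theorem stmt_10 (n p q l r : ℕ)
    (C : Matrix (Fin n) (Fin n) ℝ) (M : Fin l → Matrix (Fin n) (Fin n) ℝ)
    (R0 : Matrix (Fin p) (Fin p) ℝ) (R : Fin l → Matrix (Fin p) (Fin p) ℝ)
    (h0 : Fin q → ℝ) (h : Fin l → Fin q → ℝ) (b : Fin l → ℝ)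
    (hC : C.PosSemidef) (hM : ∀ i, (M i).PosSemidef)
    (hR0 : R0.IsSymm) (hR : ∀ i, (R i).IsSymm)
    (hfeas : ∃ (X : Matrix (Fin n) (Fin n) ℝ) (Y : Matrix (Fin p) (Fin p) ℝ)
      (lam : Fin q → ℝ), X.PosSemidef ∧ Y.PosSemidef ∧
        ∀ i, (M i * X).trace ≤ b i + (R i * Y).trace + h i ⬝ᵥ lam)
    (hslater : ∃ μ : Fin l → ℝ, (∀ i, 0 ≤ μ i) ∧ ((∑ i, μ i • M i) - C).PosDef ∧
      (-(R0 + ∑ i, μ i • R i)).PosDef ∧ h0 + ∑ i, μ i • h i = 0)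
    (hrank : C.rank = r) :
    ∃ (X : Matrix (Fin n) (Fin n) ℝ) (Y : Matrix (Fin p) (Fin p) ℝ) (lam : Fin q → ℝ),
      (X.PosSemidef ∧ Y.PosSemidef ∧
        ∀ i, (M i * X).trace ≤ b i + (R i * Y).trace + h i ⬝ᵥ lam) ∧
      X.rank ≤ r ∧
      ∀ (X' : Matrix (Fin n) (Fin n) ℝ) (Y' : Matrix (Fin p) (Fin p) ℝ)
        (lam' : Fin q → ℝ), X'.PosSemidef → Y'.PosSemidef →
        (∀ i, (M i * X').trace ≤ b i + (R i * Y').trace + h i ⬝ᵥ lam') →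
        (C * X').trace + (R0 * Y').trace + h0 ⬝ᵥ lam' ≤
          (C * X).trace + (R0 * Y).trace + h0 ⬝ᵥ lam := by
  classical
  obtain ⟨μ, hμ, hS, hT, hh⟩ := hslater
  obtain ⟨X0, Y0, l0, hX0, hY0, hf0⟩ := hfeas
  set S := (∑ i, μ i • M i) - C with hSdef
  set T := -(R0 + ∑ i, μ i • R i) with hTdef
  have bound : ∀ (X : Matrix (Fin n) (Fin n) ℝ) (Y : Matrix (Fin p) (Fin p) ℝ)
      (lam : Fin q → ℝ), (∀ i, (M i * X).trace ≤ b i + (R i * Y).trace + h i ⬝ᵥ lam) →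
      (C * X).trace + (R0 * Y).trace + h0 ⬝ᵥ lam + (S * X).trace + (T * Y).trace
        ≤ ∑ i, μ i * b i := by
    intro X Y lam hf
    have h1 : ∑ i, μ i * (M i * X).trace ≤
        ∑ i, μ i * (b i + (R i * Y).trace + h i ⬝ᵥ lam) :=
      Finset.sum_le_sum fun i _ => mul_le_mul_of_nonneg_left (hf i) (hμ i)
    have h2 : (S * X).trace = ∑ i, μ i * (M i * X).trace - (C * X).trace := by
      simp [hSdef, Matrix.sub_mul, Matrix.sum_mul, trace_sum]
    have h3 : (T * Y).trace = -((R0 * Y).trace + ∑ i, μ i * (R i * Y).trace) := by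
      rw [hTdef, Matrix.neg_mul, Matrix.add_mul, trace_neg, trace_add, Matrix.sum_mul, trace_sum]
      simp
    have h4 : h0 ⬝ᵥ lam + ∑ i, μ i * (h i ⬝ᵥ lam) = 0 := by
      have := congrArg (fun w => w ⬝ᵥ lam) hh
      simpa [add_dotProduct, sum_dotProduct] using this
    simp only [mul_add, Finset.sum_add_distrib] at h1
    linarith
  obtain ⟨ε, hε, hSε⟩ := aux_eps hS
  obtain ⟨δ, hδ, hTδ⟩ := aux_eps hT
  let a : Option (Fin l) → Fin q → ℝ := fun o => o.elim h0 h
  let d : Matrix (Fin n) (Fin n) ℝ × Matrix (Fin p) (Fin p) ℝ × ℝ → Option (Fin l) → ℝ :=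
    fun z o => o.elim (z.2.2 - (C * z.1).trace - (R0 * z.2.1).trace)
      (fun i => (M i * z.1).trace - b i - (R i * z.2.1).trace)
  have hd : Continuous d := by
    refine continuous_pi fun o => ?_
    rcases o with _ | i
    · simp only [d, Option.elim]; fun_prop
    · simp only [d, Option.elim]; fun_prop
  let t0 := (C * X0).trace + (R0 * Y0).trace + h0 ⬝ᵥ l0
  let B := ∑ i, μ i * b i
  let K1 := (B - t0) / ε
  let K2 := (B - t0) / δ
  let E : Set (Matrix (Fin n) (Fin n) ℝ × Matrix (Fin p) (Fin p) ℝ × ℝ) :=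
    {z | z.1.PosSemidef} ∩ {z | z.2.1.PosSemidef} ∩
      (d ⁻¹' {e | ∃ v : Fin q → ℝ, ∀ i, e i ≤ a i ⬝ᵥ v}) ∩ {z | t0 ≤ z.2.2}
  have hEc : IsClosed E := by
    refine IsClosed.inter (IsClosed.inter (IsClosed.inter ?_ ?_) ?_) ?_
    · exact (aux_closed_psd n).preimage continuous_fst
    · exact (aux_closed_psd p).preimage (continuous_fst.comp continuous_snd)
    · exact (aux_poly q _ a).preimage hd
    · exact isClosed_le (by fun_prop) (by fun_prop)
  have hE : ∀ z ∈ E, ∃ lam : Fin q → ℝ,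
      (∀ i, (M i * z.1).trace ≤ b i + (R i * z.2.1).trace + h i ⬝ᵥ lam) ∧
      z.2.2 ≤ (C * z.1).trace + (R0 * z.2.1).trace + h0 ⬝ᵥ lam := by
    rintro z ⟨⟨-, v, hv⟩, -⟩
    refine ⟨v, fun i => ?_, ?_⟩
    · have := hv (some i)
      simp only [d, a, Option.elim] at this
      linarith
    · have := hv none
      simp only [d, a, Option.elim] at this
      linarith
  have hE' : ∀ (X : Matrix (Fin n) (Fin n) ℝ) (Y : Matrix (Fin p) (Fin p) ℝ)
      (lam : Fin q → ℝ), X.PosSemidef → Y.PosSemidef →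
      (∀ i, (M i * X).trace ≤ b i + (R i * Y).trace + h i ⬝ᵥ lam) →
      t0 ≤ (C * X).trace + (R0 * Y).trace + h0 ⬝ᵥ lam →
      (X, Y, (C * X).trace + (R0 * Y).trace + h0 ⬝ᵥ lam) ∈ E := by
    intro X Y lam hX hY hf ht
    refine ⟨⟨⟨hX, hY⟩, lam, ?_⟩, ht⟩
    rintro (_ | i)
    · simp only [d, a, Option.elim]; linarith
    · have := hf i
      simp only [d, a, Option.elim]; linarith
  have hbox : E ⊆ (Set.univ.pi fun _ => Set.univ.pi fun _ => Set.Icc (-K1) K1) ×ˢ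
      ((Set.univ.pi fun _ => Set.univ.pi fun _ => Set.Icc (-K2) K2) ×ˢ Set.Icc t0 B) := by
    intro z hz
    obtain ⟨lam, hf, hv⟩ := hE z hz
    have hb := bound z.1 z.2.1 lam hf
    obtain ⟨⟨⟨hX, hY⟩, -⟩, ht⟩ := hz
    replace hX : z.1.PosSemidef := hX
    replace hY : z.2.1.PosSemidef := hY
    replace ht : t0 ≤ z.2.2 := ht
    have e1 := aux_trace_mul hSε hX
    have e2 := aux_trace_mul hTδ hY
    simp only [Matrix.sub_mul, Matrix.smul_mul, Matrix.one_mul, trace_sub, trace_smul,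
      smul_eq_mul] at e1 e2
    have p1 := mul_nonneg hε.le hX.trace_nonneg
    have p2 := mul_nonneg hδ.le hY.trace_nonneg
    have q1 : z.1.trace ≤ K1 := by
      rw [le_div_iff₀ hε]; simp only [B]; linarith
    have q2 : z.2.1.trace ≤ K2 := by
      rw [le_div_iff₀ hδ]; simp only [B]; linarith
    refine ⟨fun i _ j _ => ?_, fun i _ j _ => ?_, ht, ?_⟩
    · exact abs_le.1 ((aux_entry hX i j).trans q1)
    · exact abs_le.1 ((aux_entry hY i j).trans q2)
    · simp only [B]; linarith
  have hcomp : IsCompact E := by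
    refine IsCompact.of_isClosed_subset ?_ hEc hbox
    exact (isCompact_univ_pi fun _ => isCompact_univ_pi fun _ => isCompact_Icc).prod
      ((isCompact_univ_pi fun _ => isCompact_univ_pi fun _ => isCompact_Icc).prod isCompact_Icc)
  have hne : E.Nonempty := ⟨_, hE' X0 Y0 l0 hX0 hY0 hf0 le_rfl⟩
  obtain ⟨z, hz, hmax⟩ := hcomp.exists_isMaxOn hne (f := fun z => z.2.2) (by fun_prop)
  obtain ⟨lam, hf, hv⟩ := hE z hz
  obtain ⟨⟨⟨hX, hY⟩, -⟩, ht⟩ := hz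
  replace hX : z.1.PosSemidef := hX
  replace hY : z.2.1.PosSemidef := hY
  replace ht : t0 ≤ z.2.2 := ht
  obtain ⟨X', hX', hle, hrk, htr⟩ := aux_rank hC hX
  refine ⟨X', z.2.1, lam, ⟨hX', hY, fun i => ?_⟩, hrank ▸ hrk, ?_⟩
  · have := aux_trace_mul (hM i) hle
    rw [Matrix.mul_sub, trace_sub] at this
    linarith [hf i]
  · intro X1 Y1 l1 hX1 hY1 hf1
    rw [htr]
    refine le_trans ?_ hv
    by_cases hc : t0 ≤ (C * X1).trace + (R0 * Y1).trace + h0 ⬝ᵥ l1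
    · exact hmax (hE' X1 Y1 l1 hX1 hY1 hf1 hc)
    · exact (not_le.1 hc).le.trans ht
end

section
/- Assume the combined semidefinite packing problem (P_CMB) has a feasible triple, that the refined Slater condition holds for its dual (there exists μ̄ ≥ 0 with Σ_i μ̄_i M_i − C positive definite, R_0 + Σ_i μ̄_i R_i negative definite, and h_0 + Hμ̄ = 0), that rank C = r and C ≠ 0. Let r̄ := min_{i ∈ {1,…,l}} rank M_i. Then every optimal triple (X, Y, λ) of (P_CMB) satisfies rank X ≤ n − r̄ + r. -/
open Matrix

lemma aux_factor_s11 {n : ℕ} {X : Matrix (Fin n) (Fin n) ℝ} (hX : X.PosSemidef) :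
    ∃ B : Matrix (Fin n) (Fin n) ℝ, X = B * Bᴴ := by
  open scoped MatrixOrder in
  obtain ⟨B, rfl⟩ := CStarAlgebra.nonneg_iff_eq_star_mul_self.mp hX.nonneg
  exact ⟨Bᴴ, by simp [star_eq_conjTranspose]⟩

lemma aux_trace {n : ℕ} {M : Matrix (Fin n) (Fin n) ℝ} (hM : M.PosSemidef)
    (T : Matrix (Fin n) (Fin n) ℝ) :
    0 ≤ (M * (T * Tᴴ)).trace ∧ ((M * (T * Tᴴ)).trace = 0 → M * T = 0) := by
  obtain ⟨B, rfl⟩ := aux_factor_s11 hM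
  have e : (B * Bᴴ * (T * Tᴴ)).trace = ((Bᴴ * T)ᴴ * (Bᴴ * T)).trace := by
    rw [conjTranspose_mul, conjTranspose_conjTranspose, ← Matrix.mul_assoc (B * Bᴴ),
      Matrix.trace_mul_comm]
    simp only [Matrix.mul_assoc]
  rw [e]
  refine ⟨(posSemidef_conjTranspose_mul_self _).trace_nonneg, fun h => ?_⟩
  rw [trace_conjTranspose_mul_self_eq_zero_iff] at h
  rw [Matrix.mul_assoc, h, Matrix.mul_zero]

lemma aux_rank_add {n : ℕ} (A B : Matrix (Fin n) (Fin n) ℝ) :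
    (A + B).rank ≤ A.rank + B.rank := by
  have h1 : LinearMap.range (A + B).mulVecLin
      ≤ LinearMap.range A.mulVecLin ⊔ LinearMap.range B.mulVecLin := by
    rintro _ ⟨v, rfl⟩
    rw [mulVecLin_add, LinearMap.add_apply]
    exact Submodule.add_mem_sup ⟨v, rfl⟩ ⟨v, rfl⟩
  exact (Submodule.finrank_mono h1).trans (Submodule.finrank_add_le_finrank_add_finrank _ _)

lemma aux_proj_s11 {n : ℕ} {S : Matrix (Fin n) (Fin n) ℝ} (hS : S.IsHermitian) :
    ∃ Q : Matrix (Fin n) (Fin n) ℝ, Qᴴ = Q ∧ Q * Q = Q ∧ S * Q = S ∧ Q.rank ≤ S.rank := by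
  obtain ⟨U, e, hU, hSe⟩ : ∃ (U : Matrix (Fin n) (Fin n) ℝ) (e : Fin n → ℝ),
      Uᴴ * U = 1 ∧ S = U * diagonal e * Uᴴ := by
    refine ⟨hS.eigenvectorUnitary, hS.eigenvalues, ?_, ?_⟩
    · exact Unitary.coe_star_mul_self hS.eigenvectorUnitary
    · have := hS.spectral_theorem
      rw [Unitary.conjStarAlgAut_apply] at this
      exact this
  have key : ∀ a b : Fin n → ℝ, (U * diagonal a * Uᴴ) * (U * diagonal b * Uᴴ)
      = U * diagonal (fun i => a i * b i) * Uᴴ := by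
    intro a b
    calc _ = U * diagonal a * (Uᴴ * U) * diagonal b * Uᴴ := by simp only [Matrix.mul_assoc]
      _ = _ := by rw [hU, Matrix.mul_one, Matrix.mul_assoc U, diagonal_mul_diagonal]
  refine ⟨U * diagonal (fun i => e i * (e i)⁻¹) * Uᴴ, ?_, ?_, ?_, ?_⟩
  · simp [Matrix.mul_assoc]
  · rw [key]
    congr 3
    funext i
    by_cases h : e i = 0 <;> simp [h]
  · rw [hSe, key]
    congr 3
    funext i
    by_cases h : e i = 0 <;> simp [h]
  · rw [← key e (fun i => (e i)⁻¹), ← hSe]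
    exact rank_mul_le_left _ _


/-- Under feasibility of (P_CMB), the refined Slater condition for its dual, `rank C = r`
and `C ≠ 0`, every optimal triple `(X, Y, λ)` of (P_CMB) satisfies
`rank X ≤ n - r̄ + r`, where `r̄ = min_i rank (M i)`. -/
theorem stmt_11 (n p q l r : ℕ) (hl : 0 < l)
    (C : Matrix (Fin n) (Fin n) ℝ) (M : Fin l → Matrix (Fin n) (Fin n) ℝ)
    (R0 : Matrix (Fin p) (Fin p) ℝ) (R : Fin l → Matrix (Fin p) (Fin p) ℝ)
    (h0 : Fin q → ℝ) (h : Fin l → Fin q → ℝ) (b : Fin l → ℝ)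
    (hC : C.PosSemidef) (hC0 : C ≠ 0) (hM : ∀ i, (M i).PosSemidef)
    (hR0 : R0.IsSymm) (hR : ∀ i, (R i).IsSymm)
    (hfeas : ∃ (X : Matrix (Fin n) (Fin n) ℝ) (Y : Matrix (Fin p) (Fin p) ℝ)
      (lam : Fin q → ℝ), X.PosSemidef ∧ Y.PosSemidef ∧
        ∀ i, (M i * X).trace ≤ b i + (R i * Y).trace + h i ⬝ᵥ lam)
    (hslater : ∃ μ : Fin l → ℝ, (∀ i, 0 ≤ μ i) ∧ ((∑ i, μ i • M i) - C).PosDef ∧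
      (-(R0 + ∑ i, μ i • R i)).PosDef ∧ h0 + ∑ i, μ i • h i = 0)
    (hrank : C.rank = r) :
    ∀ (X : Matrix (Fin n) (Fin n) ℝ) (Y : Matrix (Fin p) (Fin p) ℝ) (lam : Fin q → ℝ),
      (X.PosSemidef ∧ Y.PosSemidef ∧
        ∀ i, (M i * X).trace ≤ b i + (R i * Y).trace + h i ⬝ᵥ lam) →
      (∀ (X' : Matrix (Fin n) (Fin n) ℝ) (Y' : Matrix (Fin p) (Fin p) ℝ)
        (lam' : Fin q → ℝ), X'.PosSemidef → Y'.PosSemidef →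
        (∀ i, (M i * X').trace ≤ b i + (R i * Y').trace + h i ⬝ᵥ lam') →
        (C * X').trace + (R0 * Y').trace + h0 ⬝ᵥ lam' ≤
          (C * X).trace + (R0 * Y).trace + h0 ⬝ᵥ lam) →
      X.rank ≤ n - (⨅ i, (M i).rank) + r := by
  rintro X Y lam ⟨hX, hY, hcon⟩ hopt
  obtain ⟨B, hB⟩ := aux_factor_s11 hX
  have hS : (Bᴴ * C * B).IsHermitian := (hC.conjTranspose_mul_mul_same B).1
  obtain ⟨Q, hQ1, hQ2, hQ3, hQ4⟩ := aux_proj_s11 hS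
  have hQr : Q.rank ≤ r := by
    refine hQ4.trans ?_
    rw [← hrank]
    exact (rank_mul_le_left _ _).trans (rank_mul_le_right _ _)
  set P := 1 - Q with hP
  have hP1 : Pᴴ = P := by rw [hP, conjTranspose_sub, hQ1, conjTranspose_one]
  have hP2 : P * P = P := by
    rw [hP]; simp [sub_mul, mul_sub, hQ2]
  have hXd : X = (B * Q) * (B * Q)ᴴ + (B * P) * (B * P)ᴴ := by
    have e1 : (B * Q) * (B * Q)ᴴ = B * Q * Bᴴ := by
      rw [conjTranspose_mul, hQ1, ← Matrix.mul_assoc, Matrix.mul_assoc B, hQ2]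
    have e2 : (B * P) * (B * P)ᴴ = B * P * Bᴴ := by
      rw [conjTranspose_mul, hP1, ← Matrix.mul_assoc, Matrix.mul_assoc B, hP2]
    rw [e1, e2, ← Matrix.add_mul, ← Matrix.mul_add, hP, add_sub_cancel, Matrix.mul_one, hB]
  have hCP : (C * ((B * P) * (B * P)ᴴ)).trace = 0 := by
    have : (C * ((B * P) * (B * P)ᴴ)).trace = (Pᴴ * ((Bᴴ * C * B) * P)).trace := by
      rw [← Matrix.mul_assoc, Matrix.trace_mul_comm, conjTranspose_mul]
      simp only [Matrix.mul_assoc]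
    rw [this, hP, Matrix.mul_sub, hQ3, Matrix.mul_one, sub_self, Matrix.mul_zero, trace_zero]
  -- some constraint matrix vanishes on the range of `B * P`
  have hex : ∃ i, M i * (B * P) = 0 := by
    by_contra! hne
    have hpos : ∀ i, (M i * ((B * Q) * (B * Q)ᴴ)).trace
        < b i + (R i * Y).trace + h i ⬝ᵥ lam := by
      intro i
      have h1 := aux_trace (hM i) (B * P)
      have h2 : 0 < (M i * ((B * P) * (B * P)ᴴ)).trace :=
        lt_of_le_of_ne h1.1 (fun h => hne i (h1.2 h.symm))
      have h3 := hcon i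
      rw [hXd, Matrix.mul_add, trace_add] at h3
      linarith
    have hev : ∀ᶠ ε : ℝ in nhdsWithin 0 (Set.Ioi 0), ∀ i,
        (M i * ((B * Q) * (B * Q)ᴴ)).trace + ε * (M i).trace
        < b i + (R i * Y).trace + h i ⬝ᵥ lam := by
      rw [Filter.eventually_all]
      intro i
      have hc : Filter.Tendsto (fun ε : ℝ => (M i * ((B * Q) * (B * Q)ᴴ)).trace
          + ε * (M i).trace) (nhds 0) (nhds ((M i * ((B * Q) * (B * Q)ᴴ)).trace
          + 0 * (M i).trace)) := Continuous.tendsto (by fun_prop) 0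
      refine (hc.mono_left nhdsWithin_le_nhds).eventually_lt_const ?_
      simpa using hpos i
    obtain ⟨ε, hε, hε0⟩ := (hev.and self_mem_nhdsWithin).exists
    have hε0 : 0 < ε := hε0
    have hCt : 0 < C.trace := by
      refine lt_of_le_of_ne hC.trace_nonneg (fun h => hC0 ?_)
      exact (hC.trace_eq_zero_iff).1 h.symm
    have hfin := hopt ((B * Q) * (B * Q)ᴴ + ε • 1) Y lam
      ((posSemidef_self_mul_conjTranspose _).add (PosSemidef.one.smul hε0.le)) hY (by
        intro i
        have := (hε i).le
        simpa [Matrix.mul_add, trace_add] using this)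
    have h5 : (C * X).trace = (C * ((B * Q) * (B * Q)ᴴ)).trace := by
      conv_lhs => rw [hXd, Matrix.mul_add, trace_add, hCP, add_zero]
    have h6 : (C * ((B * Q) * (B * Q)ᴴ + ε • 1)).trace
        = (C * ((B * Q) * (B * Q)ᴴ)).trace + ε * C.trace := by
      rw [Matrix.mul_add, trace_add]; simp
    have := mul_pos hε0 hCt
    linarith
  obtain ⟨i, hi⟩ := hex
  have r1 : (M i).rank + (B * P).rank ≤ n := by
    simpa using rank_add_rank_le_card_of_mul_eq_zero hi
  have r2 : X.rank = B.rank := by rw [hB, rank_self_mul_conjTranspose]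
  have r3 : B.rank ≤ (B * Q).rank + (B * P).rank := by
    have : B = B * Q + B * P := by
      rw [← Matrix.mul_add, hP, add_sub_cancel, Matrix.mul_one]
    conv_lhs => rw [this]
    exact aux_rank_add _ _
  have r4 : (B * Q).rank ≤ Q.rank := rank_mul_le_right _ _
  have r5 : (⨅ i, (M i).rank) ≤ (M i).rank := ciInf_le (OrderBot.bddBelow _) i
  omega
end
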